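/- Let n ≥ 3 be an integer, and define S_n(s) = Σ_{k=0}^∞ [(n)_k/((n/2+1)_k (k+1))]·s^{k+1} for s ∈ [0,1). Then lim_{s → 0⁺} s^{n/2−1}·S_n(1−s) = Γ(n/2+1)·Γ(n/2−1)/Γ(n). -/

import Mathlib

open Real Filter

noncomputable def poch (x : ℝ) (k : ℕ) : ℝ := ∏ i ∈ Finset.range k, (x + i)

/-- `S_n(s) = Σ_{k≥0} (n)_k / ((n/2+1)_k (k+1)) s^{k+1}`. -/
noncomputable def Sfun (n : ℕ) (s : ℝ) : ℝ :=
  ∑' k : ℕ, poch n k / (poch ((n : ℝ) / 2 + 1) k * ((k : ℝ) + 1)) * s ^ (k + 1)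

theorem poch_pos {x : ℝ} (hx : 0 < x) (k : ℕ) : 0 < poch x k :=
  Finset.prod_pos fun _ _ => by positivity

theorem poch_eq_eval_ascPochhammer (x : ℝ) (k : ℕ) :
    poch x k = (ascPochhammer ℝ k).eval x := by
  induction k with
  | zero => simp [poch]
  | succ k ih =>
    rw [ascPochhammer_succ_eval, ← ih]
    exact Finset.prod_range_succ _ _

/-- The binomial series for `(1 - x) ^ (-a)`, evaluated at `x = 1 - s`. -/
theorem hasSum_poch_div_factorial (a : ℝ) {s : ℝ} (hs : s ∈ Set.Ioo (0 : ℝ) 1) :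
    HasSum (fun k : ℕ => poch a k / k.factorial * (1 - s) ^ k) (s ^ a)⁻¹ := by
  have hmem : (1 - s) ∈ Metric.eball (0 : ℝ) 1 := by
    rw [Metric.mem_eball, edist_zero_right, ← ofReal_norm, ← ENNReal.ofReal_one,
      ENNReal.ofReal_lt_ofReal_iff one_pos, Real.norm_eq_abs, abs_lt]
    constructor <;> linarith [hs.1, hs.2]
  have h := (Real.one_div_one_sub_rpow_hasFPowerSeriesOnBall_zero a).hasSum hmem
  convert! h using 1
  · funext k
    have hk : (k.factorial : ℝ) * Ring.multichoose a k = poch a k := by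
      rw [poch_eq_eval_ascPochhammer, ← Polynomial.ascPochhammer_smeval_eq_eval,
        ← Ring.factorial_nsmul_multichoose_eq_ascPochhammer, nsmul_eq_mul]
    have hk0 : (k.factorial : ℝ) ≠ 0 := by positivity
    rw [← hk, mul_div_cancel_left₀ _ hk0, Ring.multichoose_eq]
    simp [FormalMultilinearSeries.ofScalars]
  · simp

/-- An Abelian theorem: if `c k / b k → L` and `∑ b k x ^ k = (1 - x) ^ (-a)`, then
`∑ c k x ^ k ∼ L (1 - x) ^ (-a)` as `x → 1⁻`. -/
theorem tendsto_rpow_mul_tsum {a L : ℝ} (ha : 0 < a) {b c : ℕ → ℝ} (hb : ∀ k, 0 < b k)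
    (hsum : ∀ s ∈ Set.Ioo (0 : ℝ) 1, HasSum (fun k => b k * (1 - s) ^ k) (s ^ a)⁻¹)
    (hlim : Tendsto (fun k => c k / b k) atTop (nhds L)) :
    Tendsto (fun s : ℝ => s ^ a * ∑' k, c k * (1 - s) ^ k)
      (nhdsWithin 0 (Set.Ioi 0)) (nhds L) := by
  rw [Metric.tendsto_nhds]
  intro ε hε
  obtain ⟨N, hN⟩ := (Metric.tendsto_atTop.1 hlim) (ε / 2) (half_pos hε)
  set K : ℝ := ∑ k ∈ Finset.range N, |c k - L * b k| with hK
  have hbound : ∀ k, |c k - L * b k| ≤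
      (if k ∈ Finset.range N then |c k - L * b k| else 0) + ε / 2 * b k := by
    intro k
    have hbk := hb k
    split_ifs with hk
    · nlinarith
    · have h := (hN k (by simpa using hk)).le
      rw [Real.dist_eq] at h
      have e : c k - L * b k = (c k / b k - L) * b k := by field_simp
      rw [e, abs_mul, abs_of_pos hbk, zero_add]
      gcongr
  have hK0 : Tendsto (fun s : ℝ => s ^ a * K) (nhdsWithin 0 (Set.Ioi 0)) (nhds 0) := by
    have h := (Real.continuousAt_rpow_const 0 a (Or.inr ha.le)).tendsto.mul_const K
    rw [Real.zero_rpow ha.ne', zero_mul] at h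
    exact h.mono_left nhdsWithin_le_nhds
  filter_upwards [hK0.eventually (gt_mem_nhds (half_pos hε)),
    Ioo_mem_nhdsGT (one_pos : (0 : ℝ) < 1)] with s hsK hs
  have hx0 : 0 ≤ 1 - s := by linarith [hs.2]
  have hx1 : 1 - s ≤ 1 := by linarith [hs.1]
  have hsa : 0 < s ^ a := Real.rpow_pos_of_pos hs.1 a
  have hdom : HasSum (fun k => (if k ∈ Finset.range N then |c k - L * b k| else 0) +
      ε / 2 * (b k * (1 - s) ^ k)) (K + ε / 2 * (s ^ a)⁻¹) := by
    refine HasSum.add ?_ ((hsum s hs).mul_left _)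
    rw [hK, ← Finset.sum_congr rfl fun k hk => if_pos hk]
    exact hasSum_sum_of_ne_finset_zero fun k hk => if_neg hk
  have hle : ∀ k, ‖(c k - L * b k) * (1 - s) ^ k‖ ≤
      (if k ∈ Finset.range N then |c k - L * b k| else 0) + ε / 2 * (b k * (1 - s) ^ k) := by
    intro k
    have hp0 : 0 ≤ (1 - s) ^ k := pow_nonneg hx0 k
    have hp1 : (1 - s) ^ k ≤ 1 := pow_le_one₀ hx0 hx1
    rw [Real.norm_eq_abs, abs_mul, abs_of_nonneg hp0]
    have hite : 0 ≤ (if k ∈ Finset.range N then |c k - L * b k| else 0) := by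
      split_ifs <;> positivity
    nlinarith [mul_le_mul_of_nonneg_right (hbound k) hp0, mul_le_mul_of_nonneg_left hp1 hite]
  have hd := tsum_of_norm_bounded hdom hle
  have hdsum : Summable fun k => (c k - L * b k) * (1 - s) ^ k :=
    Summable.of_norm_bounded hdom.summable hle
  have hc : ∑' k, c k * (1 - s) ^ k =
      (∑' k, (c k - L * b k) * (1 - s) ^ k) + L * (s ^ a)⁻¹ := by
    rw [← (hdsum.hasSum.add ((hsum s hs).mul_left L)).tsum_eq]
    exact tsum_congr fun k => by ring
  have hdiff : s ^ a * ∑' k, c k * (1 - s) ^ k - L =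
      s ^ a * ∑' k, (c k - L * b k) * (1 - s) ^ k := by
    rw [hc]
    field_simp
    ring
  rw [Real.dist_eq, hdiff, abs_mul, abs_of_pos hsa, ← Real.norm_eq_abs]
  calc _ ≤ s ^ a * (K + ε / 2 * (s ^ a)⁻¹) := by gcongr
    _ = s ^ a * K + ε / 2 := by field_simp
    _ < ε := by linarith

theorem poch_succ_eq_div_GammaSeq {x : ℝ} (hx : 0 < x) {m : ℕ} (hm : m ≠ 0) :
    poch x (m + 1) = (m : ℝ) ^ x * m.factorial / Real.GammaSeq x m := by
  have hp := (poch_pos hx (m + 1)).ne'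
  have hm' : (0 : ℝ) < m := by positivity
  have h : Real.GammaSeq x m = (m : ℝ) ^ x * m.factorial / poch x (m + 1) := rfl
  rw [h, div_div_cancel₀]
  positivity

/-- If `x = y + a`, the quotient `(x)_k k! / ((y)_k (k + 1) (a)_k)` tends to
`Γ(y) Γ(a) / Γ(x)`. -/
theorem tendsto_poch_ratio {y a : ℝ} (hy : 0 < y) (ha : 0 < a) :
    Tendsto (fun k : ℕ => poch (y + a) k / (poch y k * ((k : ℝ) + 1)) /
      (poch a k / k.factorial)) atTop
      (nhds (Real.Gamma y * Real.Gamma a / Real.Gamma (y + a))) := by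
  have hya := add_pos hy ha
  rw [← tendsto_add_atTop_iff_nat 1]
  have h1 : Tendsto (fun m : ℕ => ((m : ℝ) + 1) / (m + 1 + 1)) atTop (nhds 1) := by
    have h := (tendsto_natCast_div_add_atTop (1 : ℝ)).comp (tendsto_add_atTop_nat 1)
    refine h.congr fun m => ?_
    simp
  have h2 := h1.mul (((Real.GammaSeq_tendsto_Gamma y).mul (Real.GammaSeq_tendsto_Gamma a)).div
    (Real.GammaSeq_tendsto_Gamma (y + a)) (Real.Gamma_pos_of_pos hya).ne')
  rw [one_mul] at h2
  refine h2.congr' ?_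
  filter_upwards [eventually_ne_atTop 0] with m hm
  have hm' : (0 : ℝ) < m := by positivity
  have hG : ∀ x : ℝ, 0 < x → Real.GammaSeq x m ≠ 0 := fun x hx =>
    div_ne_zero (by positivity) (poch_pos hx (m + 1)).ne'
  have hGy := hG y hy
  have hGa := hG a ha
  have hGya := hG _ hya
  have hpy : (m : ℝ) ^ y ≠ 0 := by positivity
  have hpa : (m : ℝ) ^ a ≠ 0 := by positivity
  have hf : (m.factorial : ℝ) ≠ 0 := by positivity
  rw [poch_succ_eq_div_GammaSeq hy hm, poch_succ_eq_div_GammaSeq ha hm,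
    poch_succ_eq_div_GammaSeq hya hm, Real.rpow_add hm', Nat.factorial_succ]
  simp only [Pi.div_apply]
  push_cast
  field_simp

theorem stmt_19 (n : ℕ) (hn : 3 ≤ n) :
    Tendsto (fun s : ℝ => s ^ ((n : ℝ) / 2 - 1) * Sfun n (1 - s))
      (nhdsWithin 0 (Set.Ioi 0))
      (nhds (Real.Gamma ((n : ℝ) / 2 + 1) * Real.Gamma ((n : ℝ) / 2 - 1) / Real.Gamma n)) := by
  have hn' : (3 : ℝ) ≤ n := by exact_mod_cast hn
  have ha : (0 : ℝ) < (n : ℝ) / 2 - 1 := by linarith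
  have hratio := tendsto_poch_ratio (by linarith : (0 : ℝ) < (n : ℝ) / 2 + 1) ha
  rw [show (n : ℝ) / 2 + 1 + ((n : ℝ) / 2 - 1) = n by ring] at hratio
  have h := tendsto_rpow_mul_tsum ha
    (fun k => div_pos (poch_pos ha k) (Nat.cast_pos.2 k.factorial_pos))
    (fun s hs => hasSum_poch_div_factorial _ hs) hratio
  have hx : Tendsto (fun s : ℝ => 1 - s) (nhdsWithin 0 (Set.Ioi 0)) (nhds 1) := by
    have h0 : Tendsto (fun s : ℝ => 1 - s) (nhds 0) (nhds (1 - 0)) :=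
      (continuous_const.sub continuous_id).tendsto 0
    rw [sub_zero] at h0
    exact h0.mono_left nhdsWithin_le_nhds
  have hmul := h.mul hx
  rw [mul_one] at hmul
  refine hmul.congr fun s => ?_
  rw [Sfun, mul_assoc, ← tsum_mul_right]
  congr 1
  exact tsum_congr fun k => by ring
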